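/- arXiv:2301.09711 — 3 statements merged into one kernel-verified Lean document; each statement's English description precedes it below -/
import Mathlib

section
/- Let K ⊆ L be finite fields with |K| = q and [L : K] = r (so |L| = q^r), and let R be a commutative ring equipped with an L-algebra structure. Then the map Ψ : L ⊗_K R → ∏_{d ∈ ℤ/rℤ} R determined on pure tensors by Ψ(x ⊗ a)_d = (algebraMap L R)(x^{q^d}) · a is a well-defined bijective ring homomorphism (here x^{q^d} is well defined for d ∈ ℤ/rℤ since x^{q^r} = x for all x ∈ L). Moreover Ψ intertwines the q-power Frobenius of L with the coordinate shift: Ψ(x^q ⊗ a)_d = Ψ(x ⊗ a)_{d+1} for all x ∈ L, a ∈ R, d ∈ ℤ/rℤ. -/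
open scoped TensorProduct

/-- The Moore matrix of a basis of an extension of finite fields is invertible. -/
lemma FiniteField.isUnit_mooreMatrix {K L : Type*} [Field K] [Field L] [Algebra K L]
    [Fintype K] [Finite L] {r : ℕ} [NeZero r] (hr : Module.finrank K L = r)
    (b : Module.Basis (ZMod r) K L) :
    IsUnit (Matrix.of fun d i : ZMod r ↦ b i ^ Fintype.card K ^ d.val) := by
  rw [← Matrix.linearIndependent_rows_iff_isUnit, Fintype.linearIndependent_iff]
  intro c hc
  have hinj : Function.Injective
      fun d : ZMod r ↦ FiniteField.frobeniusAlgHom K L ^ d.val := by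
    intro d d' h
    have h' := (FiniteField.bijective_frobeniusAlgHom_pow K L).1
      (a₁ := ⟨d.val, d.val_lt.trans_eq hr.symm⟩) (a₂ := ⟨d'.val, d'.val_lt.trans_eq hr.symm⟩) h
    exact ZMod.val_injective r (Fin.mk.inj h')
  refine Fintype.linearIndependent_iff.1
    ((linearIndependent_algHom_toLinearMap K L L).comp _ hinj) c ?_
  refine b.ext fun i ↦ ?_
  simpa [AlgHom.coe_pow, FiniteField.coe_frobeniusAlgHom, pow_iterate] using congrFun hc i

/-- If a family of algebra endomorphisms of `L` has an invertible matrix of values on a basis,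
the induced map `L ⊗ R → ∏ R` is bijective. -/
lemma AlgHom.bijective_pi_productMap {K L R ι : Type*} [CommRing K] [CommRing L] [Algebra K L]
    [CommRing R] [Algebra K R] [Algebra L R] [IsScalarTower K L R] [Fintype ι] [DecidableEq ι]
    (b : Module.Basis ι K L) (σ : ι → L →ₐ[K] L)
    (hσ : IsUnit (Matrix.of fun d i : ι ↦ σ d (b i))) :
    Function.Bijective (AlgHom.pi fun d : ι ↦ Algebra.TensorProduct.productMap
      ((IsScalarTower.toAlgHom K L R).comp (σ d)) (AlgHom.id K R)) := by
  set Ψ := AlgHom.pi fun d : ι ↦ Algebra.TensorProduct.productMap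
      ((IsScalarTower.toAlgHom K L R).comp (σ d)) (AlgHom.id K R) with hΨ
  obtain ⟨⟨M, N, hMN, hNM⟩, rfl : M = _⟩ := hσ
  let g : (ι → R) →ₗ[K] L ⊗[K] R := ∑ i, (TensorProduct.mk K L R (b i)) ∘ₗ
    ∑ e, (LinearMap.mulLeft K (algebraMap L R (N i e))) ∘ₗ LinearMap.proj e
  have hg (f) : g f = ∑ i, b i ⊗ₜ[K] ∑ e, algebraMap L R (N i e) * f e := by
    simp [g, TensorProduct.tmul_sum]
  have hleft : g ∘ₗ Ψ.toLinearMap = LinearMap.id := by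
    refine TensorProduct.ext (b.ext fun j ↦ LinearMap.ext fun a ↦ ?_)
    have key (i : ι) : ∑ e, algebraMap L R (N i e) * (algebraMap L R (σ e (b j)) * a) =
        if i = j then a else 0 := by
      have h := congrArg (algebraMap L R) (congrFun (congrFun hNM i) j)
      simp only [Matrix.mul_apply, Matrix.of_apply, map_sum, map_mul, Matrix.one_apply] at h
      simp only [← mul_assoc, ← Finset.sum_mul, h]
      split_ifs <;> simp
    simp [hg, hΨ, key, TensorProduct.tmul_ite]
  have hright (f) : Ψ (g f) = f := by
    ext d
    have key (e : ι) : ∑ i, algebraMap L R (σ d (b i)) * (algebraMap L R (N i e) * f e) =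
        if d = e then f e else 0 := by
      have h := congrArg (algebraMap L R) (congrFun (congrFun hMN d) e)
      simp only [Matrix.mul_apply, Matrix.of_apply, map_sum, map_mul, Matrix.one_apply] at h
      simp only [← mul_assoc, ← Finset.sum_mul, h]
      split_ifs <;> simp
    simp only [hg, hΨ, map_sum, AlgHom.pi_apply,
      Algebra.TensorProduct.productMap_apply_tmul, AlgHom.comp_apply,
      IsScalarTower.coe_toAlgHom', AlgHom.id_apply, Finset.mul_sum]
    rw [Finset.sum_comm]
    simp [key]
  exact Function.bijective_iff_has_inverse.2 ⟨g, LinearMap.congr_fun hleft, hright⟩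

/-- Frobenius fiber products: for finite fields `K ⊆ L` with `|K| = q` and `[L : K] = r`,
and an `L`-algebra `R`, the map `x ⊗ a ↦ (d ↦ (x ^ q ^ d) • a)` is a ring isomorphism
`L ⊗[K] R ≃ ∏_{d ∈ ℤ/r} R` intertwining the `q`-power Frobenius of `L` with the shift. -/
theorem stmt5 (K L : Type*) [Field K] [Field L] [Algebra K L] [Fintype K] [Fintype L]
    (R : Type*) [CommRing R] [Algebra K R] [Algebra L R] [IsScalarTower K L R]
    (q r : ℕ) (hq : Fintype.card K = q) (hr : Module.finrank K L = r) :
    ∃ Ψ : (L ⊗[K] R) →+* (ZMod r → R),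
      Function.Bijective Ψ ∧
      (∀ (x : L) (a : R) (d : ZMod r),
        Ψ (x ⊗ₜ[K] a) d = algebraMap L R (x ^ q ^ d.val) * a) ∧
      (∀ (x : L) (a : R) (d : ZMod r),
        Ψ ((x ^ q) ⊗ₜ[K] a) d = Ψ (x ⊗ₜ[K] a) (d + 1)) := by
  have : NeZero r := ⟨hr ▸ Module.finrank_pos.ne'⟩
  have hσ (d : ZMod r) (x : L) :
      (FiniteField.frobeniusAlgHom K L ^ d.val) x = x ^ q ^ d.val := by
    simp [AlgHom.coe_pow, FiniteField.coe_frobeniusAlgHom, pow_iterate, hq]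
  let b : Module.Basis (ZMod r) K L :=
    (Module.finBasisOfFinrankEq K L hr).reindex (ZMod.finEquiv r).toEquiv
  let Ψ := AlgHom.pi fun d : ZMod r ↦ Algebra.TensorProduct.productMap
    ((IsScalarTower.toAlgHom K L R).comp (FiniteField.frobeniusAlgHom K L ^ d.val))
    (AlgHom.id K R)
  have hΨ (x : L) (a : R) (d : ZMod r) :
      Ψ (x ⊗ₜ[K] a) d = algebraMap L R (x ^ q ^ d.val) * a := by
    simp only [Ψ, AlgHom.pi_apply, Algebra.TensorProduct.productMap_apply_tmul,
      AlgHom.comp_apply, IsScalarTower.coe_toAlgHom', AlgHom.id_apply, hσ]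
  refine ⟨Ψ.toRingHom, AlgHom.bijective_pi_productMap b _ ?_, hΨ, fun x a d ↦ ?_⟩
  · simpa only [hσ, hq] using FiniteField.isUnit_mooreMatrix hr b
  · refine (hΨ _ _ _).trans (Eq.trans ?_ (hΨ _ _ _).symm)
    have hcard : Fintype.card L = q ^ r := by
      rw [Module.card_eq_pow_finrank (K := K), hq, hr]
    rw [← pow_mul, ← pow_succ']
    by_cases h : d.val + 1 < r
    · have : Fact (1 < r) := ⟨by omega⟩
      rw [ZMod.val_add_of_lt (by rwa [ZMod.val_one]), ZMod.val_one]
    · have hd : d.val + 1 = r := by have := d.val_lt; omega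
      have h0 : d + 1 = 0 := by
        rw [← ZMod.natCast_zmod_val d, ← Nat.cast_one, ← Nat.cast_add, hd, ZMod.natCast_self]
      rw [h0, hd, ← hcard, FiniteField.pow_card]
      simp
end

section
/- Let p be a prime, e ≥ 1, q = p^e, and let R be a commutative ring of characteristic p. For c ∈ R, let A = R[X]/(X^q − X − c) (AdjoinRoot of the polynomial X^q − X − C c). Then: (i) A is a free R-module of rank q; (ii) the R-algebra A is étale (formally étale and of finite presentation); and (iii) the induced map on prime spectra, PrimeSpectrum A → PrimeSpectrum R, is surjective. -/
open Polynomial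

theorem AdjoinRoot.etale_of_isUnit_derivative {R : Type*} [CommRing R] {f : R[X]} (hf : f.Monic)
    (h : IsUnit (AdjoinRoot.mk f f.derivative)) : Algebra.Etale R (AdjoinRoot f) := by
  obtain ⟨u, hu⟩ := h.exists_right_inv
  obtain ⟨b, rfl⟩ := AdjoinRoot.mk_surjective u
  rw [← map_mul, ← sub_eq_zero, ← map_one (AdjoinRoot.mk f), ← map_sub, AdjoinRoot.mk_eq_zero] at hu
  obtain ⟨a, ha⟩ := hu
  let P : StandardEtalePair R :=
    { f := f, monic_f := hf, g := 1, cond := ⟨b, -a, 0, by linear_combination ha⟩ }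
  have : IsUnit (AdjoinRoot.mk P.f P.g) := by simp [P]
  let e : AdjoinRoot P.f ≃ₐ[AdjoinRoot P.f] Localization.Away (AdjoinRoot.mk P.f P.g) :=
    IsLocalization.atUnit _ _ _ this
  exact Algebra.Etale.of_equiv (P.equivAwayAdjoinRoot.trans (e.restrictScalars R).symm)

theorem Polynomial.natDegree_X_pow_sub_X_sub_C {R : Type*} [CommRing R] [Nontrivial R] {q : ℕ}
    (hq : 1 < q) (c : R) : (X ^ q - X - C c).natDegree = q := by
  rw [sub_sub, natDegree_sub_eq_left_of_natDegree_lt, natDegree_X_pow]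
  rwa [natDegree_X_add_C, natDegree_X_pow]

theorem Polynomial.monic_X_pow_sub_X_sub_C {R : Type*} [CommRing R] {q : ℕ}
    (hq : 1 < q) (c : R) : (X ^ q - X - C c).Monic := by
  nontriviality R
  rw [sub_sub]
  exact (monic_X_pow q).sub_of_left (by
    rw [degree_X_pow, degree_X_add_C]; exact_mod_cast hq)

/-- Artin–Schreier covers: for `q = p ^ e` and `R` of characteristic `p`, the
`R`-algebra `A = R[X]/(X ^ q - X - c)` is free of rank `q`, étale, and
`Spec A → Spec R` is surjective. -/
theorem stmt6 (p : ℕ) (hp : p.Prime) (e : ℕ) (he : 1 ≤ e) (q : ℕ) (hq : q = p ^ e)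
    (R : Type) [CommRing R] [CharP R p] (c : R) :
    Module.Free R (AdjoinRoot (X ^ q - X - C c)) ∧
    Module.finrank R (AdjoinRoot (X ^ q - X - C c)) = q ∧
    Algebra.Etale R (AdjoinRoot (X ^ q - X - C c)) ∧
    Function.Surjective
      (PrimeSpectrum.comap (algebraMap R (AdjoinRoot (X ^ q - X - C c)))) := by
  have : Nontrivial R := CharP.nontrivial_of_char_ne_one hp.ne_one
  have hq1 : 1 < q := hq ▸ Nat.one_lt_pow (by omega) hp.one_lt
  have hqR : (q : R) = 0 := by simp [hq, show e ≠ 0 by omega]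
  have hf := monic_X_pow_sub_X_sub_C hq1 c
  have hdeg := natDegree_X_pow_sub_X_sub_C hq1 c
  have hfree := hf.free_adjoinRoot
  have : Module.Finite R (AdjoinRoot (X ^ q - X - C c)) := hf.finite_adjoinRoot
  have hrank : Module.finrank R (AdjoinRoot (X ^ q - X - C c)) = q := by
    rw [(AdjoinRoot.powerBasis' hf).finrank, AdjoinRoot.powerBasis'_dim, hdeg]
  have : Nontrivial (AdjoinRoot (X ^ q - X - C c)) :=
    Module.nontrivial_of_finrank_pos (R := R) (by omega)
  refine ⟨hfree, hrank, ?_, ?_⟩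
  · exact AdjoinRoot.etale_of_isUnit_derivative hf (by simp [derivative_X_pow, hqR])
  · rw [PrimeSpectrum.comap_surjective_iff_injective_of_finite]
    exact FaithfulSMul.algebraMap_injective R _
end

section
/- Let R be a commutative ring, let q ≥ 2 be a natural number, and let f : R → ℝ be a ring seminorm that is nonarchimedean (f(a + b) ≤ max(f a, f b) for all a, b) and satisfies f(x^q) = (f x)^q for all x ∈ R. If x ∈ R and M ≥ 0 satisfy f(x^q − x) ≤ M, then f x ≤ max 1 (M^{1/q}). -/
/-- The Frobenius-contraction estimate: for a nonarchimedean ring seminorm `f` with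
`f (x ^ q) = (f x) ^ q`, if `f (x ^ q - x) ≤ M` then `f x ≤ max 1 (M ^ (1 / q))`. -/
theorem stmt8 (R : Type*) [CommRing R] (q : ℕ) (hq : 2 ≤ q)
    (f : RingSeminorm R)
    (hna : ∀ a b : R, f (a + b) ≤ max (f a) (f b))
    (hpow : ∀ x : R, f (x ^ q) = (f x) ^ q)
    (x : R) (M : ℝ) (hM : 0 ≤ M) (hx : f (x ^ q - x) ≤ M) :
    f x ≤ max 1 (M ^ (1 / (q : ℝ))) := by
  rw [le_max_iff, or_iff_not_imp_left, not_le]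
  intro h1
  have h : f x ^ q ≤ max M (f x) :=
    calc f x ^ q = f ((x ^ q - x) + x) := by rw [sub_add_cancel, hpow]
      _ ≤ max (f (x ^ q - x)) (f x) := hna _ _
      _ ≤ max M (f x) := max_le_max_right _ hx
  have hlt : f x < f x ^ q := lt_self_pow₀ h1 hq
  have hM' : f x ^ q ≤ M := (le_max_iff.mp h).resolve_right hlt.not_ge
  rw [one_div, Real.le_rpow_inv_iff_of_pos (apply_nonneg f x) hM (by positivity),
    Real.rpow_natCast]
  exact hM'
end
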